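/- Partial duality of Q at one edge: for any ribbon graph with flags G and any edge e ∈ E(G), Q_{G^{{e}}}(x,y,z,w,r) = Q_G(x',y',z',w',r), where x'_f = x_f, y'_f = y_f, z'_f = z_f, w'_f = w_f for every edge f ≠ e, and x'_e = y_e, y'_e = x_e, z'_e = w_e, w'_e = z_e. -/

import Mathlib

set_option linter.unusedSectionVars false

open Finset

namespace RibbonPaper

variable {X : Type} [Fintype X] [DecidableEq X]

/-- Raw combinatorial data of a ribbon graph with flags: three permutations of
the finite set of crosses. -/
structure RawRibbon (X : Type) [Fintype X] [DecidableEq X] where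
  s0 : Equiv.Perm X
  th : Equiv.Perm X
  s1 : Equiv.Perm X

namespace RawRibbon

/-- The axioms of a combinatorial map with flags (ribbon graph with flags). -/
def IsRibbon (G : RawRibbon X) : Prop :=
  G.th ^ 2 = 1 ∧ G.s1 ^ 2 = 1 ∧ G.th * G.s1 = G.s1 * G.th ∧
    (∀ x, G.th x ≠ x) ∧ (∀ x, G.th x ≠ G.s1 x) ∧
    G.s0 * G.th = G.th * G.s0⁻¹ ∧
    ∀ (x : X) (n : ℤ), (G.s0 ^ n) x ≠ G.th x

/-- A ribbon graph without flags: `σ₁` is fixed-point free. -/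
def NoFlags (G : RawRibbon X) : Prop := ∀ x, G.s1 x ≠ x

/-- The edges: 4-element orbits `{x, θx, σ₁x, σ₁θx}` of crosses not fixed by `σ₁`. -/
def edges (G : RawRibbon X) : Finset (Finset X) :=
  (Finset.univ.filter fun x => G.s1 x ≠ x).image
    fun x => ({x, G.th x, G.s1 x, G.s1 (G.th x)} : Finset X)

/-- The flags: pairs `{x, θ x}` of crosses fixed by `σ₁`. -/
def flags (G : RawRibbon X) : Finset (Finset X) :=
  (Finset.univ.filter fun x => G.s1 x = x).image fun x => ({x, G.th x} : Finset X)

/-- The half-ribbons: all pairs `{x, θ x}`. -/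
def halfRibbons (G : RawRibbon X) : Finset (Finset X) :=
  Finset.univ.image fun x => ({x, G.th x} : Finset X)

/-- Orbit of a point under a permutation, as a finset. -/
def permOrbit (f : Equiv.Perm X) (x : X) : Finset X :=
  (Finset.range (Fintype.card X)).image fun n => (f ^ n) x

/-- The vertex containing the cross `x`: the union of the `σ₀`-cycles of `x` and `θ x`. -/
def vertexOf (G : RawRibbon X) (x : X) : Finset X :=
  permOrbit G.s0 x ∪ permOrbit G.s0 (G.th x)

/-- The vertices of the ribbon graph, as finsets of crosses. -/
def vertices (G : RawRibbon X) : Finset (Finset X) :=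
  Finset.univ.image G.vertexOf

/-- `degB G B v` : the number of half-edges incident to `v` that belong to edges of `B`,
plus the number of flags incident to `v`. -/
def degB (G : RawRibbon X) (B : Finset (Finset X)) (v : Finset X) : ℕ :=
  (G.halfRibbons.filter fun h => h ⊆ v ∧ (h ∈ G.flags ∨ ∃ e ∈ B, h ⊆ e)).card

/-- `φ_S` : the permutation agreeing with `f` on `S` and the identity off `S`
(defined whenever `S` is `f`-invariant, and the identity otherwise). -/
def permRestrict (f : Equiv.Perm X) (S : Finset X) : Equiv.Perm X :=
  if h : ∀ x : X, x ∈ S ↔ f x ∈ S then Equiv.Perm.ofSubtype (f.subtypePerm fun x => (h x).symm) else 1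

/-- The set of crosses of a set of edges. -/
def crossSet (E' : Finset (Finset X)) : Finset X := E'.biUnion id

/-- Chmutov's partial dual `G^{E'}`. -/
def partialDual (G : RawRibbon X) (E' : Finset (Finset X)) : RawRibbon X where
  s0 := G.s0 * permRestrict G.th (crossSet E') * permRestrict G.s1 (crossSet E')
  th := permRestrict G.s1 (crossSet E') * permRestrict G.th (crossSet E')ᶜ
  s1 := permRestrict G.s1 (crossSet E')ᶜ * permRestrict G.th (crossSet E')

/-- The topological polynomial `Q` of a ribbon graph with flags. -/
def Qpoly {R : Type} [CommRing R] (G : RawRibbon X) (x y z w : Finset X → R) (r : ℕ → R) : R :=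
  ∑ A ∈ G.edges.powerset, ∑ B ∈ (G.partialDual A).edges.powerset,
    (∏ e ∈ (G.edges \ A) ∩ ((G.partialDual A).edges \ B), x e) *
      (∏ e ∈ A ∩ ((G.partialDual A).edges \ B), y e) *
      (∏ e ∈ A ∩ B, z e) *
      (∏ e ∈ (G.edges \ A) ∩ B, w e) *
      ∏ v ∈ (G.partialDual A).vertices, r (degB (G.partialDual A) B v)

/-- The first hyperbolic polynomial `HU` as an evaluation of `Q`. -/
noncomputable def HU (G : RawRibbon X) (Ω t : Finset X → ℝ) : ℝ :=
  Qpoly G t Ω (fun e => Ω e * t e ^ 2) (fun e => t e * Ω e ^ 2)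
    fun n => if Even n then 0 else 2

end RawRibbon

end RibbonPaper

theorem test : True := trivial
namespace RibbonPaper

namespace RawRibbon

variable {X : Type} [Fintype X] [DecidableEq X]

lemma firstRet_exists (f : Equiv.Perm X) (S : Finset X) {x : X} (hx : x ∈ S) :
    ∃ k : ℕ, 0 < k ∧ (f ^ k) x ∈ S :=
  ⟨orderOf f, orderOf_pos f, by rw [pow_orderOf_eq_one]; simpa using hx⟩

open scoped Classical in
/-- The first-return map of a permutation on a subset. -/
noncomputable def firstRet (f : Equiv.Perm X) (S : Finset X) (x : X) : X :=
  if h : ∃ k : ℕ, 0 < k ∧ (f ^ k) x ∈ S then (f ^ Nat.find h) x else x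

lemma firstRet_mem (f : Equiv.Perm X) (S : Finset X) {x : X} (hx : x ∈ S) :
    firstRet f S x ∈ S := by
  rw [firstRet, dif_pos (firstRet_exists f S hx)]
  exact (Nat.find_spec (firstRet_exists f S hx)).2

lemma firstRet_inj_aux (f : Equiv.Perm X) (S : Finset X) {x y : X}
    (hx : x ∈ S) (hy : y ∈ S)
    (hle : Nat.find (firstRet_exists f S hx) ≤ Nat.find (firstRet_exists f S hy))
    (h : firstRet f S x = firstRet f S y) : x = y := by
  have hex := firstRet_exists f S hx
  have hey := firstRet_exists f S hy
  rw [firstRet, dif_pos hex, firstRet, dif_pos hey] at h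
  have hxy : x = (f ^ (Nat.find hey - Nat.find hex)) y := by
    apply Equiv.injective (f ^ Nat.find hex)
    rw [← Equiv.Perm.mul_apply, ← pow_add, Nat.add_sub_cancel' hle]
    exact h
  by_cases h0 : Nat.find hey - Nat.find hex = 0
  · rw [h0, pow_zero] at hxy
    simpa using hxy
  · exfalso
    have hlt : Nat.find hey - Nat.find hex < Nat.find hey :=
      Nat.sub_lt (Nat.find_spec hey).1 (Nat.find_spec hex).1
    apply Nat.find_min hey hlt
    refine ⟨Nat.pos_of_ne_zero h0, ?_⟩
    rw [hxy] at hx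
    exact hx

lemma firstRet_inj (f : Equiv.Perm X) (S : Finset X) {x y : X}
    (hx : x ∈ S) (hy : y ∈ S) (h : firstRet f S x = firstRet f S y) : x = y := by
  rcases le_total (Nat.find (firstRet_exists f S hx)) (Nat.find (firstRet_exists f S hy)) with
    hle | hle
  · exact firstRet_inj_aux f S hx hy hle h
  · exact (firstRet_inj_aux f S hy hx hle h.symm).symm

/-- The permutation induced on a subset `S` by a permutation of `X`
(the first-return map). -/
noncomputable def inducedPerm (f : Equiv.Perm X) (S : Finset X) : Equiv.Perm {x : X // x ∈ S} :=
  Equiv.ofBijective (fun a => ⟨firstRet f S a.1, firstRet_mem f S a.2⟩)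
    (Finite.injective_iff_bijective.mp fun a b hab =>
      Subtype.ext (firstRet_inj f S a.2 b.2 (congrArg Subtype.val hab)))

/-- The ribbon graph obtained by restricting to a subset `S` of the crosses
(deleting all crosses outside `S`). -/
noncomputable def restrict (G : RawRibbon X) (S : Finset X) : RawRibbon {x : X // x ∈ S} :=
  ⟨inducedPerm G.s0 S, inducedPerm G.th S, inducedPerm G.s1 S⟩

/-- Deletion of an edge `e` (given by its finset of crosses). -/
noncomputable def delete (G : RawRibbon X) (e : Finset X) : RawRibbon {x : X // x ∈ eᶜ} :=
  G.restrict eᶜ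

/-- The cut of an edge `e`: `σ₁` is replaced by `(σ₁)_{X∖e}`, so the two
half-edges of `e` become flags. -/
def cut (G : RawRibbon X) (e : Finset X) : RawRibbon X :=
  ⟨G.s0, G.th, permRestrict G.s1 eᶜ⟩

/-- Connectivity: the crosses form a single orbit under the group generated by the
three permutations. -/
def Connected (G : RawRibbon X) : Prop :=
  ∀ x y : X, ∃ g ∈ Subgroup.closure ({G.s0, G.th, G.s1} : Set (Equiv.Perm X)), g x = y

/-- Two vertices are linked by an edge of `A` if `e ∈ A` has a half-edge incident to each. -/
def linked (G : RawRibbon X) (A : Finset (Finset X)) (u v : Finset X) : Prop :=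
  ∃ e ∈ A, (∃ h ∈ G.halfRibbons, h ⊆ e ∧ h ⊆ u) ∧ ∃ h ∈ G.halfRibbons, h ⊆ e ∧ h ⊆ v

/-- Connectivity of two vertices in the spanning subgraph `(V(G), A)`. -/
def vconn (G : RawRibbon X) (A : Finset (Finset X)) : Finset X → Finset X → Prop :=
  Relation.ReflTransGen (G.linked A)

/-- The spanning subgraph `(V(G), A)` is connected. -/
def SpanningConn (G : RawRibbon X) (A : Finset (Finset X)) : Prop :=
  ∀ u ∈ G.vertices, ∀ v ∈ G.vertices, G.vconn A u v

/-- The number of faces (boundary components) of a ribbon graph: the number of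
vertices of its natural dual. -/
def nFaces (G : RawRibbon X) : ℕ := (G.partialDual G.edges).vertices.card

/-- The number of boundary components of the spanning subgraph of `G` with surviving
crosses `S`, counting also the vertices of `G` that have become isolated. -/
noncomputable def nBoundary (G : RawRibbon X) (S : Finset X) : ℕ :=
  (G.restrict S).nFaces + (G.vertices.filter fun v => Disjoint v S).card

/-- A spanning quasi-tree: the spanning subgraph `(V(G), A)` is connected and has
exactly one face. -/
def IsQuasiTree (G : RawRibbon X) (A : Finset (Finset X)) : Prop :=
  G.SpanningConn A ∧ G.nBoundary (crossSet A) = 1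

/-- A spanning tree: the spanning subgraph `(V(G), A)` is connected and
`|A| = v(G) - 1`. -/
def IsSpanningTree (G : RawRibbon X) (A : Finset (Finset X)) : Prop :=
  G.SpanningConn A ∧ A.card + 1 = G.vertices.card

open scoped Classical in
/-- The first Symanzik polynomial of the noncommutative heat-kernel theory. -/
noncomputable def Upoly (G : RawRibbon X) (α : Finset X → ℝ) (θ : ℝ) : ℝ :=
  ∑ A ∈ G.edges.powerset.filter (fun A => G.IsQuasiTree A),
    (θ / 2) ^ (A.card + 1 - G.vertices.card) * ∏ e ∈ G.edges \ A, α e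

end RawRibbon

end RibbonPaper
namespace RibbonPaper

namespace RawRibbon

variable {X : Type} [Fintype X] [DecidableEq X]

/-- Even spanning subgraphs of `G`. -/
def evenSubs (G : RawRibbon X) : Finset (Finset (Finset X)) :=
  G.edges.powerset.filter fun B => ∀ v ∈ G.vertices, Even (G.degB B v)

/-- Odd spanning subgraphs of `G`. -/
def oddSubs (G : RawRibbon X) : Finset (Finset (Finset X)) :=
  G.edges.powerset.filter fun B => ∀ v ∈ G.vertices, Odd (G.degB B v)

/-- Odd cutting spanning subgraphs of `G`: subsets of half-ribbons such that every
vertex is incident to an odd number of them. -/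
def oddCutting (G : RawRibbon X) : Finset (Finset (Finset X)) :=
  G.halfRibbons.powerset.filter fun H =>
    ∀ v ∈ G.vertices, Odd ((H.filter fun h => h ⊆ v).card)

/-- Even cutting spanning subgraphs of `G`. -/
def evenCutting (G : RawRibbon X) : Finset (Finset (Finset X)) :=
  G.halfRibbons.powerset.filter fun H =>
    ∀ v ∈ G.vertices, Even ((H.filter fun h => h ⊆ v).card)

/-- The flag-set of a cutting spanning subgraph `H`: the flags of `G` contained in `H`
together with the edges exactly one of whose two half-edges lies in `H`. -/
def flagSetOf (G : RawRibbon X) (H : Finset (Finset X)) : Finset (Finset X) :=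
  (G.flags ∩ H) ∪ (G.edges.filter fun e => (H.filter fun h => h ⊆ e).card = 1)

/-- Orientability of a ribbon graph with flags. -/
def Orientable (G : RawRibbon X) : Prop :=
  ∃ Xp : Finset X,
    Xp.image G.s0 = Xp ∧ Disjoint Xp (Xp.image G.th) ∧
      Xp ∪ Xp.image G.th = Finset.univ ∧
      ∀ x : X, G.s1 x ≠ x → (x ∈ Xp ↔ G.s1 x ∉ Xp)

/-- The edge variable of the edge of `G` containing the half-ribbon `h`
(as a product over the containing edges; a flag contributes `1`). -/
def halfWeight {R : Type} [CommRing R] (G : RawRibbon X) (t : Finset X → R)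
    (h : Finset X) : R :=
  ∏ e ∈ G.edges.filter (fun e => h ⊆ e), t e

/-- The vertex containing a given half-ribbon. -/
def vertexOfHalf (G : RawRibbon X) (h : Finset X) : Finset X :=
  (G.vertices.filter fun v => h ⊆ v).sup id

/-- The spin product `σ_u σ_{u'}` over the endpoints of an edge `e`, for the spin
configuration assigning `+1` to vertices in `T` and `-1` to the others. -/
noncomputable def spinProd (G : RawRibbon X) (T : Finset (Finset X)) (e : Finset X) : ℝ :=
  ∏ h ∈ G.halfRibbons.filter (fun h => h ⊆ e),
    (if G.vertexOfHalf h ∈ T then (1 : ℝ) else -1)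

/-- An isolated vertex of even degree: incident to no half-edge and to an even
number of flags. -/
def IsIsolatedEvenVertex (G : RawRibbon X) (v : Finset X) : Prop :=
  v ∈ G.vertices ∧ (∀ h ∈ G.halfRibbons, h ⊆ v → h ∈ G.flags) ∧
    Even ((G.flags.filter fun h => h ⊆ v).card)

open scoped Classical in
/-- The number of endpoints of edges of `B` lying in the `A`-connected component of the
vertex `v`, plus the number of flags attached to vertices of that component. -/
noncomputable def compDeg (G : RawRibbon X) (A B : Finset (Finset X)) (v : Finset X) : ℕ :=
  (G.halfRibbons.filter fun h =>
      (h ∈ G.flags ∨ ∃ e ∈ B, h ⊆ e) ∧ ∃ u ∈ G.vertices, G.vconn A v u ∧ h ⊆ u).card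

/-- `(B, V(G/A))` is odd: every connected component of the spanning subgraph
`(V(G), A)` sees an odd number of endpoints of edges of `B` plus flags. -/
def CompOdd (G : RawRibbon X) (A B : Finset (Finset X)) : Prop :=
  ∀ v ∈ G.vertices, Odd (compDeg G A B v)

open scoped Classical in
/-- The connected component of the vertex `v` in the spanning subgraph `(V(G), A)`. -/
noncomputable def compVerts (G : RawRibbon X) (A : Finset (Finset X)) (v : Finset X) :
    Finset (Finset X) :=
  G.vertices.filter fun u => G.vconn A v u

/-- The connected components of the spanning subgraph `(V(G), A)`. -/
noncomputable def components (G : RawRibbon X) (A : Finset (Finset X)) :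
    Finset (Finset (Finset X)) :=
  G.vertices.image fun v => compVerts G A v

/-- The edges of `A` incident to a set of vertices `c`. -/
def compEdges (G : RawRibbon X) (A : Finset (Finset X)) (c : Finset (Finset X)) :
    Finset (Finset X) :=
  A.filter fun e => ∃ h ∈ G.halfRibbons, h ⊆ e ∧ ∃ u ∈ c, h ⊆ u

open scoped Classical in
/-- The cycle edges of a (unicyclic) component `c`: those edges whose removal keeps
the component connected. -/
noncomputable def cycleEdges (G : RawRibbon X) (A : Finset (Finset X))
    (c : Finset (Finset X)) : Finset (Finset X) :=
  (compEdges G A c).filter fun e => ∀ u ∈ c, ∀ u' ∈ c, G.vconn (A.erase e) u u'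

/-- The weight of a connected component in the commutative Mehler-kernel limit. -/
noncomputable def compWeight (G : RawRibbon X) (A : Finset (Finset X)) (Ω t : Finset X → ℝ)
    (c : Finset (Finset X)) : ℝ :=
  if (compEdges G A c).card + 1 = c.card then
    (2 : ℝ) ^ (1 - ((compEdges G A c).card : ℤ)) *
      ∑ e ∈ compEdges G A c,
        Ω e ^ 2 * t e * ∏ e' ∈ (compEdges G A c).erase e, Ω e' * (1 + t e' ^ 2)
  else
    (2 : ℝ) ^ (2 - ((compEdges G A c).card : ℤ)) *
      ∑ C' ∈ (cycleEdges G A c).powerset.filter (fun C' => Odd C'.card),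
        (∏ e ∈ C', Ω e * t e ^ 2) *
          ∏ e' ∈ compEdges G A c \ cycleEdges G A c, Ω e' * (1 + t e' ^ 2)

/-- The graph `Ĝ_{i₀}` : the half-edge `i₀` (with crosses `x₀, θ x₀`) is detached from
its vertex, replaced there by a flag (crosses `inr 0, inr 1`), and attached to a new
bivalent vertex carrying one more flag (crosses `inr 2, inr 3`). -/
def hatGraph (G : RawRibbon X) (x₀ : X) : RawRibbon (X ⊕ Fin 4) where
  s0 :=
    (Equiv.swap (Sum.inl x₀) (Sum.inr 0) * Equiv.swap (Sum.inl (G.th x₀)) (Sum.inr 1)) *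
        Equiv.sumCongr G.s0 (Equiv.refl (Fin 4)) *
        (Equiv.swap (Sum.inl x₀) (Sum.inr 0) * Equiv.swap (Sum.inl (G.th x₀)) (Sum.inr 1))⁻¹ *
      Equiv.swap (Sum.inl x₀) (Sum.inr 2) * Equiv.swap (Sum.inl (G.th x₀)) (Sum.inr 3)
  th := Equiv.sumCongr G.th (Equiv.swap 0 1 * Equiv.swap 2 3)
  s1 := Equiv.sumCongr G.s1 (Equiv.refl (Fin 4))

end RawRibbon

end RibbonPaper
namespace RibbonPaper

namespace RawRibbon

section dualProof

variable {X : Type} [Fintype X] [DecidableEq X]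

/-- The `⟨θ, σ₁⟩`-orbit of a cross. -/
def orb (G : RawRibbon X) (x : X) : Finset X := {x, G.th x, G.s1 x, G.s1 (G.th x)}

/-- Elementary consequences of the ribbon axioms not involving `σ₀`. -/
structure Good (G : RawRibbon X) : Prop where
  tt : ∀ x, G.th (G.th x) = x
  ss : ∀ x, G.s1 (G.s1 x) = x
  ts : ∀ x, G.th (G.s1 x) = G.s1 (G.th x)
  tx : ∀ x, G.th x ≠ x
  tn : ∀ x, G.th x ≠ G.s1 x

lemma IsRibbon.good {G : RawRibbon X} (h : G.IsRibbon) : G.Good := by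
  obtain ⟨h1, h2, h3, h4, h5, -, -⟩ := h
  refine ⟨fun x => ?_, fun x => ?_, fun x => ?_, h4, h5⟩
  · have := congrArg (fun p : Equiv.Perm X => p x) h1
    simpa [pow_two] using this
  · have := congrArg (fun p : Equiv.Perm X => p x) h2
    simpa [pow_two] using this
  · have := congrArg (fun p : Equiv.Perm X => p x) h3
    simpa using this

lemma orb_th {G : RawRibbon X} (h : G.Good) (x : X) : G.orb (G.th x) = G.orb x := by
  ext a
  simp only [orb, h.tt, Finset.mem_insert, Finset.mem_singleton]
  tauto

lemma orb_s1 {G : RawRibbon X} (h : G.Good) (x : X) : G.orb (G.s1 x) = G.orb x := by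
  ext a
  simp only [orb, h.ss, h.ts, Finset.mem_insert, Finset.mem_singleton]
  tauto

lemma mem_edges {G : RawRibbon X} (f : Finset X) :
    f ∈ G.edges ↔ ∃ x, G.s1 x ≠ x ∧ G.orb x = f := by
  simp [edges, orb]

lemma orb_eq {G : RawRibbon X} (h : G.Good) {f : Finset X} (hf : f ∈ G.edges) {x : X}
    (hx : x ∈ f) : G.orb x = f ∧ G.s1 x ≠ x := by
  obtain ⟨a, ha, rfl⟩ := (mem_edges f).1 hf
  have hx' := hx
  simp only [orb, Finset.mem_insert, Finset.mem_singleton] at hx'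
  have e1 : G.s1 (G.th a) ≠ G.th a := by
    rw [← h.ts]
    exact fun hh => ha (G.th.injective hh)
  rcases hx' with rfl | rfl | rfl | rfl
  · exact ⟨rfl, ha⟩
  · exact ⟨orb_th h _, e1⟩
  · exact ⟨orb_s1 h _, by rw [h.ss]; exact ha.symm⟩
  · exact ⟨by rw [orb_s1 h, orb_th h], by rw [h.ss]; exact e1.symm⟩

lemma mem_crossSet {G : RawRibbon X} (h : G.Good) {A : Finset (Finset X)} (hA : A ⊆ G.edges)
    (x : X) : x ∈ crossSet A ↔ G.orb x ∈ A := by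
  simp only [crossSet, Finset.mem_biUnion, id]
  constructor
  · rintro ⟨f, hf, hx⟩
    rwa [(orb_eq h (hA hf) hx).1]
  · intro hx
    exact ⟨_, hx, by simp [orb]⟩

lemma permRestrict_apply (f : Equiv.Perm X) (S : Finset X) (h : ∀ x : X, x ∈ S ↔ f x ∈ S) (x : X) :
    permRestrict f S x = if x ∈ S then f x else x := by
  rw [permRestrict, dif_pos h]
  split_ifs with hx
  · rw [Equiv.Perm.ofSubtype_apply_of_mem _ hx]
    simp
  · rw [Equiv.Perm.ofSubtype_apply_of_not_mem _ hx]

lemma pd_apply {G : RawRibbon X} (h : G.Good) {A : Finset (Finset X)} (hA : A ⊆ G.edges) (x : X) :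
    (G.partialDual A).s0 x = (if G.orb x ∈ A then G.s0 (G.th (G.s1 x)) else G.s0 x) ∧
    (G.partialDual A).th x = (if G.orb x ∈ A then G.s1 x else G.th x) ∧
    (G.partialDual A).s1 x = (if G.orb x ∈ A then G.th x else G.s1 x) := by
  have ht : ∀ x, x ∈ crossSet A ↔ G.th x ∈ crossSet A := fun x => by
    rw [mem_crossSet h hA, mem_crossSet h hA, orb_th h]
  have hs : ∀ x, x ∈ crossSet A ↔ G.s1 x ∈ crossSet A := fun x => by
    rw [mem_crossSet h hA, mem_crossSet h hA, orb_s1 h]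
  have ht' : ∀ x, x ∈ (crossSet A)ᶜ ↔ G.th x ∈ (crossSet A)ᶜ := fun x => by
    simp only [Finset.mem_compl, ← ht]
  have hs' : ∀ x, x ∈ (crossSet A)ᶜ ↔ G.s1 x ∈ (crossSet A)ᶜ := fun x => by
    simp only [Finset.mem_compl, ← hs]
  simp only [partialDual, Equiv.Perm.mul_apply, permRestrict_apply _ _ ht,
    permRestrict_apply _ _ hs, permRestrict_apply _ _ ht', permRestrict_apply _ _ hs',
    Finset.mem_compl, mem_crossSet h hA]
  by_cases hx : G.orb x ∈ A <;> simp [hx, orb_th h, orb_s1 h]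

lemma pd_orb {G : RawRibbon X} (h : G.Good) {A : Finset (Finset X)} (hA : A ⊆ G.edges) (x : X) :
    (G.partialDual A).orb x = G.orb x := by
  ext a
  have e1 : (G.partialDual A).orb x = {x, (G.partialDual A).th x, (G.partialDual A).s1 x,
      (G.partialDual A).s1 ((G.partialDual A).th x)} := rfl
  have e2 : G.orb x = {x, G.th x, G.s1 x, G.s1 (G.th x)} := rfl
  rw [e1]
  by_cases hx : G.orb x ∈ A
  · simp only [(pd_apply h hA _).2, orb_s1 h, hx, if_true, h.ts]
    rw [e2]
    simp only [Finset.mem_insert, Finset.mem_singleton]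
    tauto
  · simp only [(pd_apply h hA _).2, orb_th h, hx, if_false]
    rw [e2]

lemma pd_edges {G : RawRibbon X} (h : G.Good) {A : Finset (Finset X)} (hA : A ⊆ G.edges) :
    (G.partialDual A).edges = G.edges := by
  ext f
  simp only [mem_edges, pd_orb h hA, (pd_apply h hA _).2]
  refine exists_congr fun x => and_congr_left fun _ => ?_
  by_cases hx : G.orb x ∈ A
  · have := (orb_eq h (hA hx) (x := x) (by simp [orb])).2
    simp [hx, h.tx, this]
  · simp [hx]

lemma pd_good {G : RawRibbon X} (h : G.Good) {A : Finset (Finset X)} (hA : A ⊆ G.edges) :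
    (G.partialDual A).Good := by
  constructor <;> intro x <;> simp only [(pd_apply h hA _).2] <;>
    by_cases hx : G.orb x ∈ A <;>
    simp [hx, orb_th h, orb_s1 h, h.tt, h.ss, h.ts, h.tx, h.tn, (h.tn _).symm]
  exact (orb_eq h (hA hx) (x := x) (by simp [orb])).2

lemma pd_pd {G : RawRibbon X} (h : G.Good) {A B : Finset (Finset X)} (hA : A ⊆ G.edges)
    (hB : B ⊆ G.edges) :
    (G.partialDual A).partialDual B = G.partialDual (symmDiff B A) := by
  have hAB : symmDiff B A ⊆ G.edges := by
    intro f hf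
    rw [Finset.mem_symmDiff] at hf
    rcases hf with hf | hf
    exacts [hB hf.1, hA hf.1]
  have hB' : B ⊆ (G.partialDual A).edges := by rwa [pd_edges h hA]
  have key : ∀ K L : RawRibbon X, (∀ x, K.s0 x = L.s0 x) → (∀ x, K.th x = L.th x) →
      (∀ x, K.s1 x = L.s1 x) → K = L := by
    rintro ⟨a, b, c⟩ ⟨a', b', c'⟩ h1 h2 h3
    congr 1 <;> ext x
    exacts [h1 x, h2 x, h3 x]
  have hg := pd_good h hA
  apply key <;> intro x <;>
    simp only [pd_apply hg hB', pd_apply h hAB, pd_apply h hA, pd_orb h hA, Finset.mem_symmDiff] <;>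
    by_cases h1 : G.orb x ∈ A <;> by_cases h2 : G.orb x ∈ B <;>
    simp [h1, h2, orb_th h, orb_s1 h, h.tt, h.ss, h.ts]

/-- `Q` with the edges of the partial duals identified with those of `G`. -/
lemma Qpoly_eq {R : Type} [CommRing R] {G : RawRibbon X} (h : G.Good)
    (x y z w : Finset X → R) (r : ℕ → R) :
    Qpoly G x y z w r = ∑ A ∈ G.edges.powerset, ∑ B ∈ G.edges.powerset,
      (∏ f ∈ G.edges, if f ∈ A then (if f ∈ B then z f else y f)
        else (if f ∈ B then w f else x f)) *
      ∏ v ∈ (G.partialDual A).vertices, r (degB (G.partialDual A) B v) := by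
  unfold Qpoly
  refine Finset.sum_congr rfl fun A hA => ?_
  have hA := Finset.mem_powerset.1 hA
  rw [pd_edges h hA]
  refine Finset.sum_congr rfl fun B hB => ?_
  have hB := Finset.mem_powerset.1 hB
  congr 1
  have conv : ∀ (C : Finset (Finset X)) (u : Finset X → R), C ⊆ G.edges →
      ∏ f ∈ C, u f = ∏ f ∈ G.edges, if f ∈ C then u f else 1 := by
    intro C u hC
    rw [Finset.prod_ite_mem, Finset.inter_eq_right.2 hC]
  rw [conv _ x (Finset.inter_subset_left.trans Finset.sdiff_subset),
    conv _ y (Finset.inter_subset_left.trans hA),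
    conv _ z (Finset.inter_subset_left.trans hA),
    conv _ w (Finset.inter_subset_left.trans Finset.sdiff_subset),
    ← Finset.prod_mul_distrib, ← Finset.prod_mul_distrib, ← Finset.prod_mul_distrib]
  refine Finset.prod_congr rfl fun f hf => ?_
  by_cases h1 : f ∈ A <;> by_cases h2 : f ∈ B <;> simp [h1, h2, hf]

end dualProof

end RawRibbon

end RibbonPaper

open RibbonPaper RawRibbon in
/-- partial duality of `Q` at one edge. -/
theorem statement_3 {X : Type} [Fintype X] [DecidableEq X] {R : Type} [CommRing R]
    (G : RawRibbon X) (hG : G.IsRibbon) (e : Finset X) (he : e ∈ G.edges)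
    (x y z w : Finset X → R) (r : ℕ → R) :
    Qpoly (G.partialDual {e}) x y z w r =
      Qpoly G (fun f => if f = e then y f else x f) (fun f => if f = e then x f else y f)
        (fun f => if f = e then w f else z f) (fun f => if f = e then z f else w f) r := by
  have h := hG.good
  have he' : ({e} : Finset (Finset X)) ⊆ G.edges := by simpa using he
  rw [Qpoly_eq (pd_good h he'), Qpoly_eq h, pd_edges h he']
  have hmap : ∀ A ∈ G.edges.powerset, symmDiff A {e} ∈ G.edges.powerset := by
    intro A hA
    rw [Finset.mem_powerset] at hA ⊢
    intro f hf
    rw [Finset.mem_symmDiff] at hf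
    rcases hf with hf | hf
    exacts [hA hf.1, he' hf.1]
  refine Finset.sum_nbij' (fun A => symmDiff A {e}) (fun A => symmDiff A {e}) hmap hmap
    (fun A _ => symmDiff_symmDiff_cancel_right _ _)
    (fun A _ => symmDiff_symmDiff_cancel_right _ _) ?_
  intro A hA
  refine Finset.sum_congr rfl fun B hB => ?_
  rw [pd_pd h he' (Finset.mem_powerset.1 hA)]
  congr 1
  refine Finset.prod_congr rfl fun f hf => ?_
  by_cases h0 : f = e <;> by_cases h1 : f ∈ A <;> by_cases h2 : f ∈ B <;>
    simp_all [Finset.mem_symmDiff]
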